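/- A graph G is (2P_3,C_4,C_6,C_7)-free and contains an induced T_0 if and only if G is a tent. -/

import Mathlib

open SimpleGraph

namespace Paper2P3

variable {V : Type*}

/-- `G` contains an induced subgraph isomorphic to `H`. -/
def ContainsInduced {V W : Type*} (G : SimpleGraph V) (H : SimpleGraph W) : Prop :=
  ∃ s : Set V, Nonempty (H ≃g G.induce s)

/-- `G` is `H`-free: no induced subgraph of `G` is isomorphic to `H`. -/
def HFree {V W : Type*} (G : SimpleGraph V) (H : SimpleGraph W) : Prop :=
  ¬ ContainsInduced G H

/-- `S` is complete to `T` in `G`. -/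
def Complete (G : SimpleGraph V) (S T : Set V) : Prop :=
  ∀ a ∈ S, ∀ b ∈ T, G.Adj a b

/-- `S` is anticomplete to `T` in `G`. -/
def Anticomplete (G : SimpleGraph V) (S T : Set V) : Prop :=
  ∀ a ∈ S, ∀ b ∈ T, ¬ G.Adj a b

/-- The closed neighborhood `N_G[v]`. -/
def closedNbhd (G : SimpleGraph V) (v : V) : Set V := insert v (G.neighborSet v)

/-- A simplicial vertex: its neighborhood is a clique. -/
def IsSimplicial (G : SimpleGraph V) (v : V) : Prop := G.IsClique (G.neighborSet v)

/-- A universal vertex: adjacent to all other vertices. -/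
def IsUniversalVertex (G : SimpleGraph V) (v : V) : Prop := ∀ w, w ≠ v → G.Adj v w

/-- `G` admits a clique-cutset: a clique `C ⊊ V(G)` such that `G - C` is disconnected. -/
def HasCliqueCutset (G : SimpleGraph V) : Prop :=
  ∃ C : Set V, G.IsClique C ∧ C ≠ Set.univ ∧ ¬ (G.induce Cᶜ).Connected

/-- The disjoint union of two copies of `P_3`, on vertices `0,1,2` and `3,4,5`. -/
def twoP3 : SimpleGraph (Fin 6) :=
  SimpleGraph.fromRel fun a b => (a, b) ∈ ([(0,1),(1,2),(3,4),(4,5)] : List (Fin 6 × Fin 6))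

/-- The edgeless graph on four vertices. -/
def fourK1 : SimpleGraph (Fin 4) := ⊥

/-- `Gs` is a thickening of `G`. -/
def IsThickening {α β : Type*} (Gs : SimpleGraph β) (G : SimpleGraph α) : Prop :=
  ∃ X : α → Set β,
    (∀ v, (X v).Nonempty) ∧
    (∀ u v : α, u ≠ v → Disjoint (X u) (X v)) ∧
    (⋃ v, X v) = Set.univ ∧
    (∀ v, Gs.IsClique (X v)) ∧
    (∀ u v : α, u ≠ v →
      (G.Adj u v → Complete Gs (X u) (X v)) ∧ (¬ G.Adj u v → Anticomplete Gs (X u) (X v)))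

/-- The closed neighborhoods of the vertices of `S` form a chain under inclusion;
equivalently (for finite graphs), `S` can be ordered as `a_1, …, a_r` with
`N_G[a_r] ⊆ ⋯ ⊆ N_G[a_1]`. -/
def ChainClosedNbhd (G : SimpleGraph V) (S : Set V) : Prop :=
  ∀ a ∈ S, ∀ b ∈ S, closedNbhd G a ⊆ closedNbhd G b ∨ closedNbhd G b ⊆ closedNbhd G a

/-- `A` can be partitioned into cliques, pairwise anticomplete to each other. -/
def CliquesPartition (G : SimpleGraph V) (A : Set V) : Prop :=
  ∃ (ℓ : ℕ) (P : Fin ℓ → Set V),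
    (∀ i, G.IsClique (P i)) ∧
    (∀ i j, i ≠ j → Disjoint (P i) (P j)) ∧
    (∀ i j, i ≠ j → Anticomplete G (P i) (P j)) ∧
    (⋃ i, P i) = A

/-- `A` can be partitioned into nonempty cliques, pairwise anticomplete to each other. -/
def NonemptyCliquesPartition (G : SimpleGraph V) (A : Set V) : Prop :=
  ∃ (ℓ : ℕ) (P : Fin ℓ → Set V),
    (∀ i, (P i).Nonempty) ∧
    (∀ i, G.IsClique (P i)) ∧
    (∀ i j, i ≠ j → Disjoint (P i) (P j)) ∧
    (∀ i j, i ≠ j → Anticomplete G (P i) (P j)) ∧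
    (⋃ i, P i) = A

/-- `A` can be partitioned into nonempty cliques, pairwise anticomplete to each other,
each of which can be ordered so that the closed neighborhoods form a decreasing chain. -/
def OrderedCliquesPartition (G : SimpleGraph V) (A : Set V) : Prop :=
  ∃ (ℓ : ℕ) (P : Fin ℓ → Set V),
    (∀ i, (P i).Nonempty) ∧
    (∀ i, G.IsClique (P i)) ∧
    (∀ i j, i ≠ j → Disjoint (P i) (P j)) ∧
    (∀ i j, i ≠ j → Anticomplete G (P i) (P j)) ∧
    (⋃ i, P i) = A ∧
    (∀ i, ChainClosedNbhd G (P i))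

/-- `(X_0,…,X_6; Y_0,…,Y_6; Z_0,…,Z_6; W)` is a special partition of the induced
subgraph of `G` on `S` (indices in `ℤ_7`). -/
def IsSpecialPartitionOn (G : SimpleGraph V) (S : Set V)
    (X Y Z : ZMod 7 → Set V) (W : Set V) : Prop :=
  -- the sets are pairwise disjoint and their union is `S`
  (∀ i j, i ≠ j → Disjoint (X i) (X j)) ∧
  (∀ i j, i ≠ j → Disjoint (Y i) (Y j)) ∧
  (∀ i j, i ≠ j → Disjoint (Z i) (Z j)) ∧
  (∀ i j, Disjoint (X i) (Y j)) ∧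
  (∀ i j, Disjoint (X i) (Z j)) ∧
  (∀ i j, Disjoint (Y i) (Z j)) ∧
  (∀ i, Disjoint (X i) W) ∧ (∀ i, Disjoint (Y i) W) ∧ (∀ i, Disjoint (Z i) W) ∧
  ((⋃ i, X i) ∪ (⋃ i, Y i) ∪ (⋃ i, Z i) ∪ W = S) ∧
  -- all the sets are cliques
  (∀ i, G.IsClique (X i)) ∧ (∀ i, G.IsClique (Y i)) ∧ (∀ i, G.IsClique (Z i)) ∧
  G.IsClique W ∧
  -- (a)
  (∀ i, (X i).Nonempty) ∧
  -- (b)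
  (∀ i, Complete G (X i) (X (i - 1)) ∧ Complete G (X i) (X (i + 1)) ∧
    Anticomplete G (X i) (X (i + 2)) ∧ Anticomplete G (X i) (X (i + 3)) ∧
    Anticomplete G (X i) (X (i + 4)) ∧ Anticomplete G (X i) (X (i + 5))) ∧
  -- (c)
  (∀ i, Complete G (X i) (Y i) ∧ Complete G (X i) (Y (i + 3)) ∧
    Complete G (X i) (Y (i + 6)) ∧ Complete G (X i) (Z i) ∧
    Complete G (X i) (Z (i + 3)) ∧ Complete G (X i) (Z (i + 4)) ∧
    Complete G (X i) (Z (i + 5)) ∧ Complete G (X i) (Z (i + 6)) ∧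
    Complete G (X i) W ∧
    Anticomplete G (X i) (Y (i + 1)) ∧ Anticomplete G (X i) (Y (i + 2)) ∧
    Anticomplete G (X i) (Y (i + 4)) ∧ Anticomplete G (X i) (Y (i + 5)) ∧
    Anticomplete G (X i) (Z (i + 1)) ∧ Anticomplete G (X i) (Z (i + 2))) ∧
  -- (d)
  (∀ i, (Y i).Nonempty →
    (Y (i + 1) = ∅ ∧ Y (i + 2) = ∅ ∧ Y (i + 5) = ∅ ∧ Y (i + 6) = ∅ ∧
      Z (i + 5) = ∅ ∧ Z (i + 6) = ∅) ∧ (Y (i + 3) = ∅ ∨ Y (i + 4) = ∅)) ∧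
  -- (e)
  (∀ i, (Z i).Nonempty → Z (i + 2) = ∅ ∧ Z (i + 5) = ∅) ∧
  -- (f)
  (∀ i, Complete G (Y i) (Y (i + 3)) ∧ Complete G (Y i) (Y (i + 4)) ∧
    Complete G (Y i) (Z i) ∧ Complete G (Y i) (Z (i + 1)) ∧
    Complete G (Y i) (Z (i + 3)) ∧ Complete G (Y i) (Z (i + 4)) ∧
    Complete G (Y i) W ∧ Anticomplete G (Y i) (Z (i + 2))) ∧
  -- (g)
  (∀ i, Complete G (Z i) (Z (i + 1)) ∧ Complete G (Z i) (Z (i + 3)) ∧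
    Complete G (Z i) (Z (i + 4)) ∧ Complete G (Z i) (Z (i + 6)) ∧ Complete G (Z i) W)

/-- `G` admits a special partition. -/
def AdmitsSpecialPartition (G : SimpleGraph V) : Prop :=
  ∃ (X Y Z : ZMod 7 → Set V) (W : Set V), IsSpecialPartitionOn G Set.univ X Y Z W

/-- `G` is a 7-saucer. -/
def IsSevenSaucer (G : SimpleGraph V) : Prop :=
  ∃ (X Y Z : ZMod 7 → Set V) (W A : Set V),
    IsSpecialPartitionOn G Aᶜ X Y Z W ∧
    (∀ i, Anticomplete G A (X i)) ∧
    (∀ i, Anticomplete G A (Y i) ∨ Z (i + 2) = ∅) ∧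
    (A = ∅ ∨ OrderedCliquesPartition G A)
/-- The graph `M_0`: vertices `0,…,6` are `x_0,…,x_6` (a 7-cycle), `7 = y_0`,
`8 = y_3`, `9 = z_0`, `10 = z_3`, `11 = z_4`. -/
def M0 : SimpleGraph (Fin 12) :=
  SimpleGraph.fromRel fun a b => (a, b) ∈
    ([(0,1),(1,2),(2,3),(3,4),(4,5),(5,6),(6,0),
      (7,0),(7,1),(7,4),
      (8,3),(8,4),(8,0),
      (9,0),(9,1),(9,2),(9,3),(9,4),
      (10,3),(10,4),(10,5),(10,6),(10,0),
      (11,4),(11,5),(11,6),(11,0),(11,1),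
      (7,8),(7,9),(7,10),(7,11),(8,9),(8,10),(8,11),(9,10),(9,11),(10,11)] :
      List (Fin 12 × Fin 12))

/-- The graph `M_1`: vertices `0,…,6` are `x_0,…,x_6` (a 7-cycle), `7 = y_0`, `8 = z_2`. -/
def M1 : SimpleGraph (Fin 9) :=
  SimpleGraph.fromRel fun a b => (a, b) ∈
    ([(0,1),(1,2),(2,3),(3,4),(4,5),(5,6),(6,0),
      (7,0),(7,1),(7,4),
      (8,2),(8,3),(8,4),(8,5),(8,6)] : List (Fin 9 × Fin 9))

/-- The graph `M_2`: `M_1` plus the vertex `9 = z_1`. -/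
def M2 : SimpleGraph (Fin 10) :=
  SimpleGraph.fromRel fun a b => (a, b) ∈
    ([(0,1),(1,2),(2,3),(3,4),(4,5),(5,6),(6,0),
      (7,0),(7,1),(7,4),
      (8,2),(8,3),(8,4),(8,5),(8,6),
      (9,1),(9,2),(9,3),(9,4),(9,5),(9,7),(9,8)] : List (Fin 10 × Fin 10))

/-- The graph `M_3`: `M_1` plus the vertex `9 = z_3`. -/
def M3 : SimpleGraph (Fin 10) :=
  SimpleGraph.fromRel fun a b => (a, b) ∈
    ([(0,1),(1,2),(2,3),(3,4),(4,5),(5,6),(6,0),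
      (7,0),(7,1),(7,4),
      (8,2),(8,3),(8,4),(8,5),(8,6),
      (9,3),(9,4),(9,5),(9,6),(9,0),(9,7),(9,8)] : List (Fin 10 × Fin 10))

/-- The set `{y_0, y_3, z_0, z_3, z_4}` of vertices of `M_0`. -/
def M0Extra : Set (Fin 12) := {7, 8, 9, 10, 11}

/-- `H` is a thickening of a graph in the family `ℳ`, which consists of
`M_1`, `M_2`, `M_3`, and all graphs `M_0 - S` for `S ⊆ {y_0,y_3,z_0,z_3,z_4}`. -/
def IsThickeningOfM {β : Type*} (H : SimpleGraph β) : Prop :=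
  IsThickening H M1 ∨ IsThickening H M2 ∨ IsThickening H M3 ∨
  ∃ S : Set (Fin 12), S ⊆ M0Extra ∧ IsThickening H (M0.induce Sᶜ)
/-- The graph `T_0`: vertices `0 = a_0`, `1 = a_1`, `2 = b_0`, `3 = b_1`, `4 = b_2`,
`5 = b_3`, `6 = c_1`, `7 = c_2`, `8 = c_3`. -/
def T0 : SimpleGraph (Fin 9) :=
  SimpleGraph.fromRel fun a b => (a, b) ∈
    ([(0,1),(0,2),(0,4),(0,5),(1,3),(1,4),(1,5),
      (2,6),(3,6),(4,7),(5,8),(6,7),(6,8),(7,8)] : List (Fin 9 × Fin 9))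

/-- The graph `T_1`: `T_0` plus the vertex `9 = f_3`, adjacent to
`a_0,a_1,b_0,b_1,b_2,c_1,c_2` and nonadjacent to `b_3,c_3`. -/
def T1 : SimpleGraph (Fin 10) :=
  SimpleGraph.fromRel fun a b => (a, b) ∈
    ([(0,1),(0,2),(0,4),(0,5),(1,3),(1,4),(1,5),
      (2,6),(3,6),(4,7),(5,8),(6,7),(6,8),(7,8),
      (9,0),(9,1),(9,2),(9,3),(9,4),(9,6),(9,7)] : List (Fin 10 × Fin 10))
/-- `(A_0,A_1;B_0,B_1,B_2,B_3;C_1,C_2,C_3;F_2,F_3;W;Y;Z)` is a tent partition of `G`. -/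
def IsTentPartition (G : SimpleGraph V)
    (A0 A1 B0 B1 B2 B3 C1 C2 C3 F2 F3 W Y Z : Set V) : Prop :=
  let P : Fin 14 → Set V := ![A0, A1, B0, B1, B2, B3, C1, C2, C3, F2, F3, W, Y, Z]
  -- the fourteen sets form a partition of the vertex set
  (∀ i j : Fin 14, i ≠ j → Disjoint (P i) (P j)) ∧
  (⋃ i, P i) = Set.univ ∧
  -- A_0,A_1,B_0,B_1,B_2,B_3,C_1,C_2,C_3 are nonempty cliques
  (A0.Nonempty ∧ A1.Nonempty ∧ B0.Nonempty ∧ B1.Nonempty ∧ B2.Nonempty ∧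
    B3.Nonempty ∧ C1.Nonempty ∧ C2.Nonempty ∧ C3.Nonempty) ∧
  (G.IsClique A0 ∧ G.IsClique A1 ∧ G.IsClique B0 ∧ G.IsClique B1 ∧ G.IsClique B2 ∧
    G.IsClique B3 ∧ G.IsClique C1 ∧ G.IsClique C2 ∧ G.IsClique C3) ∧
  -- F_2, F_3, Y are cliques, and at most one of them is nonempty
  (G.IsClique F2 ∧ G.IsClique F3 ∧ G.IsClique Y) ∧
  ((F2 = ∅ ∧ F3 = ∅) ∨ (F2 = ∅ ∧ Y = ∅) ∨ (F3 = ∅ ∧ Y = ∅)) ∧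
  -- W is a (possibly empty) clique
  G.IsClique W ∧
  Complete G A0 A1 ∧
  (Complete G A0 B0 ∧ Complete G A0 B2 ∧ Complete G A0 B3 ∧
    Anticomplete G A0 B1 ∧ Anticomplete G A0 C1 ∧ Anticomplete G A0 C2 ∧
    Anticomplete G A0 C3) ∧
  (Complete G A1 B1 ∧ Complete G A1 B2 ∧ Complete G A1 B3 ∧
    Anticomplete G A1 B0 ∧ Anticomplete G A1 C1 ∧ Anticomplete G A1 C2 ∧
    Anticomplete G A1 C3) ∧
  (Anticomplete G B0 B1 ∧ Anticomplete G B0 B2 ∧ Anticomplete G B0 B3 ∧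
    Anticomplete G B1 B2 ∧ Anticomplete G B1 B3 ∧ Anticomplete G B2 B3) ∧
  (Complete G C1 C2 ∧ Complete G C1 C3 ∧ Complete G C2 C3) ∧
  (Complete G C1 B0 ∧ Complete G C1 B1 ∧ Anticomplete G C1 B2 ∧ Anticomplete G C1 B3) ∧
  (Complete G C2 B2 ∧ Anticomplete G C2 B0 ∧ Anticomplete G C2 B1 ∧
    Anticomplete G C2 B3) ∧
  (Complete G C3 B3 ∧ Anticomplete G C3 B0 ∧ Anticomplete G C3 B1 ∧
    Anticomplete G C3 B2) ∧
  (Complete G F2 A0 ∧ Complete G F2 A1 ∧ Complete G F2 B0 ∧ Complete G F2 B1 ∧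
    Complete G F2 B3 ∧ Complete G F2 C1 ∧ Complete G F2 C3 ∧
    Anticomplete G F2 B2 ∧ Anticomplete G F2 C2) ∧
  (Complete G F3 A0 ∧ Complete G F3 A1 ∧ Complete G F3 B0 ∧ Complete G F3 B1 ∧
    Complete G F3 B2 ∧ Complete G F3 C1 ∧ Complete G F3 C2 ∧
    Anticomplete G F3 B3 ∧ Anticomplete G F3 C3) ∧
  (Complete G W A0 ∧ Complete G W A1 ∧ Complete G W B0 ∧ Complete G W B1 ∧
    Complete G W B2 ∧ Complete G W B3 ∧ Complete G W C1 ∧ Complete G W C2 ∧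
    Complete G W C3 ∧ Complete G W F2 ∧ Complete G W F3) ∧
  (Complete G Y C2 ∧ Complete G Y C3 ∧
    Anticomplete G Y A0 ∧ Anticomplete G Y A1 ∧ Anticomplete G Y B0 ∧
    Anticomplete G Y B1 ∧ Anticomplete G Y B2 ∧ Anticomplete G Y B3 ∧
    Anticomplete G Y C1) ∧
  (Anticomplete G Z A0 ∧ Anticomplete G Z A1 ∧ Anticomplete G Z B0 ∧
    Anticomplete G Z B1 ∧ Anticomplete G Z B2 ∧ Anticomplete G Z B3 ∧
    Anticomplete G Z C1 ∧ Anticomplete G Z C2 ∧ Anticomplete G Z C3 ∧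
    Anticomplete G Z Y) ∧
  -- Y can be ordered so that the closed neighborhoods form a chain
  ChainClosedNbhd G Y ∧
  -- Z is empty or can be partitioned into nonempty cliques, pairwise anticomplete,
  -- each ordered so that the closed neighborhoods form a chain
  (Z = ∅ ∨ OrderedCliquesPartition G Z)

/-- `G` is a tent. -/
def IsTent (G : SimpleGraph V) : Prop :=
  ∃ A0 A1 B0 B1 B2 B3 C1 C2 C3 F2 F3 W Y Z : Set V,
    IsTentPartition G A0 A1 B0 B1 B2 B3 C1 C2 C3 F2 F3 W Y Z

/-- The closed neighborhoods in the vertices `0,…,8` of `T0` of the fourteen kinds of vertices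
`A_0,A_1,B_0,B_1,B_2,B_3,C_1,C_2,C_3,F_2,F_3,W,Y,Z` of a tent. -/
def trace (i : Fin 14) (j : Fin 9) : Bool :=
  (![[0,1,2,4,5], [0,1,3,4,5], [0,2,6], [1,3,6], [0,1,4,7], [0,1,5,8],
    [2,3,6,7,8], [4,6,7,8], [5,6,7,8],
    [0,1,2,3,5,6,8], [0,1,2,3,4,6,7], [0,1,2,3,4,5,6,7,8], [7,8], []] i :
    List (Fin 9)).contains j

/-- The label of the class of the vertex `j` of `T0`. -/
def label (j : Fin 9) : Fin 14 := Fin.castLE (by decide) j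

instance : DecidableRel T0.Adj := fun a b =>
  decidable_of_iff _ (SimpleGraph.fromRel_adj _ a b).symm

theorem trace_label : ∀ j k, trace (label j) k = true ↔ j = k ∨ T0.Adj j k := by
  decide +kernel

theorem eq_of_trace_eq_off : ∀ i i' : Fin 14, ∀ j : Fin 9,
    (∀ k, k ≠ j → trace i k = trace i' k) → i = i' := by
  decide +kernel

theorem T0_eq_of_adj_iff : ∀ j k : Fin 9, (∀ l, T0.Adj j l ↔ T0.Adj k l) → j = k := by
  decide +kernel

/-- A set `s` of vertices of `T0` is convex with respect to paths of length two. -/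
def ClosedC4 (s : Fin 9 → Bool) : Prop :=
  ∀ i, s i = true → ∀ j, s j = false → T0.Adj i j → ∀ k, s k = true → T0.Adj j k →
    i ≠ k → T0.Adj i k

/-- No `2P_3` in which the new vertex, with neighborhood `s`, is an end of a path. -/
def NoEndP3 (s : Fin 9 → Bool) : Prop :=
  ∀ i, s i = true → ∀ j, s j = false → T0.Adj i j →
    ∀ k, (s k = false ∧ k ≠ i ∧ k ≠ j ∧ ¬ T0.Adj k i ∧ ¬ T0.Adj k j) →
    ∀ l, T0.Adj k l → (s l = false ∧ ¬ T0.Adj l i ∧ ¬ T0.Adj l j) →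
    ∀ m, T0.Adj l m → k ≠ m → ¬ T0.Adj k m → (s m = false ∧ ¬ T0.Adj m i ∧ ¬ T0.Adj m j) →
    False

/-- No `2P_3` in which the new vertex, with neighborhood `s`, is the center of a path. -/
def NoMidP3 (s : Fin 9 → Bool) : Prop :=
  ∀ i, s i = true → ∀ j, s j = true → i ≠ j → ¬ T0.Adj i j →
    ∀ k, (s k = false ∧ ¬ T0.Adj k i ∧ ¬ T0.Adj k j) →
    ∀ l, T0.Adj k l → (s l = false ∧ ¬ T0.Adj l i ∧ ¬ T0.Adj l j) →
    ∀ m, T0.Adj l m → k ≠ m → ¬ T0.Adj k m → (s m = false ∧ ¬ T0.Adj m i ∧ ¬ T0.Adj m j) →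
    False

/-- No `C_6` through the new vertex, with neighborhood `s`. -/
def NoC6 (s : Fin 9 → Bool) : Prop :=
  ∀ i, s i = true → ∀ j, s j = false → T0.Adj i j →
    ∀ k, s k = false → T0.Adj j k → k ≠ i → ¬ T0.Adj k i →
    ∀ l, s l = false → T0.Adj k l → l ≠ j → ¬ T0.Adj l j → ¬ T0.Adj l i →
    ∀ m, s m = true → T0.Adj l m → ¬ T0.Adj m k → ¬ T0.Adj m j → m ≠ i → T0.Adj m i

instance (s : Fin 9 → Bool) : Decidable (ClosedC4 s) := by unfold ClosedC4; infer_instance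
set_option synthInstance.maxSize 1000 in
set_option synthInstance.maxHeartbeats 200000 in
instance (s : Fin 9 → Bool) : Decidable (NoEndP3 s) := by unfold NoEndP3; infer_instance
set_option synthInstance.maxSize 1000 in
set_option synthInstance.maxHeartbeats 200000 in
instance (s : Fin 9 → Bool) : Decidable (NoMidP3 s) := by unfold NoMidP3; infer_instance
set_option synthInstance.maxSize 1000 in
set_option synthInstance.maxHeartbeats 200000 in
instance (s : Fin 9 → Bool) : Decidable (NoC6 s) := by unfold NoC6; infer_instance

theorem exists_trace : ∀ s : Fin 9 → Bool, ClosedC4 s → NoEndP3 s → NoMidP3 s → NoC6 s →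
    ∃ i, ∀ j, s j = trace i j := by
  decide +kernel

theorem containsInduced_iff {V W : Type*} {G : SimpleGraph V} {H : SimpleGraph W} :
    ContainsInduced G H ↔ Nonempty (H ↪g G) := by
  constructor
  · rintro ⟨s, ⟨e⟩⟩
    exact ⟨e.toEmbedding.trans (SimpleGraph.Embedding.induce s)⟩
  · rintro ⟨f⟩
    refine ⟨Set.range f, ⟨⟨Equiv.ofInjective f f.injective, ?_⟩⟩⟩
    intro a b
    simp

instance : DecidableRel twoP3.Adj := fun a b =>
  decidable_of_iff _ (SimpleGraph.fromRel_adj _ a b).symm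

/-- An injective map of vertices that respects adjacency and nonadjacency is an embedding. -/
theorem containsInduced_of_map {W : Type*} {G : SimpleGraph V} {H : SimpleGraph W} (f : W → V)
    (hinj : Function.Injective f) (h : ∀ a b, G.Adj (f a) (f b) ↔ H.Adj a b) :
    ContainsInduced G H :=
  containsInduced_iff.2 ⟨⟨⟨f, hinj⟩, h _ _⟩⟩

theorem adj_of_C4_free {G : SimpleGraph V} (h : HFree G (cycleGraph 4)) {a b c d : V}
    (hab : G.Adj a b) (hbc : G.Adj b c) (hcd : G.Adj c d) (hda : G.Adj d a) (hac : a ≠ c)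
    (nac : ¬ G.Adj a c) (hbd : b ≠ d) : G.Adj b d := by
  by_contra nbd
  refine h (containsInduced_of_map ![a, b, c, d] ?_ ?_)
  · intro i j
    have := hab.ne; have := hbc.ne; have := hcd.ne; have := hda.ne
    fin_cases i <;> fin_cases j <;> simp <;> grind
  · intro i j
    have hs := fun x y => G.adj_comm x y
    fin_cases i <;> fin_cases j <;> simp [cycleGraph_adj] <;> grind

theorem false_of_2P3 {G : SimpleGraph V} (h : HFree G twoP3) {a b c d e g : V}
    (hab : G.Adj a b) (hbc : G.Adj b c) (hac : a ≠ c) (nac : ¬ G.Adj a c)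
    (hde : G.Adj d e) (heg : G.Adj e g) (hdg : d ≠ g) (ndg : ¬ G.Adj d g)
    (had : ¬ G.Adj a d) (hae : ¬ G.Adj a e) (hag : ¬ G.Adj a g)
    (hbd : ¬ G.Adj b d) (hbe : ¬ G.Adj b e) (hbg : ¬ G.Adj b g)
    (hcd : ¬ G.Adj c d) (hce : ¬ G.Adj c e) (hcg : ¬ G.Adj c g) : False := by
  have key : ∀ i j, G.Adj (![a, b, c, d, e, g] i) (![a, b, c, d, e, g] j) ↔ twoP3.Adj i j := by
    intro i j
    have hs := fun x y => G.adj_comm x y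
    fin_cases i <;> fin_cases j <;> simp [twoP3] <;> grind
  refine h (containsInduced_of_map ![a, b, c, d, e, g] ?_ key)
  intro i j hij
  have := hab.ne; have := hbc.ne; have := hde.ne; have := heg.ne
  have hs := fun x y => G.adj_comm x y
  revert hij
  fin_cases i <;> fin_cases j <;> simp <;> grind

theorem false_of_C6 {G : SimpleGraph V} (h : HFree G (cycleGraph 6)) {a b c d e g : V}
    (hab : G.Adj a b) (hbc : G.Adj b c) (hcd : G.Adj c d) (hde : G.Adj d e) (heg : G.Adj e g)
    (hga : G.Adj g a)
    (hac : ¬ G.Adj a c) (had : ¬ G.Adj a d) (hae : ¬ G.Adj a e)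
    (hbd : ¬ G.Adj b d) (hbe : ¬ G.Adj b e) (hbg : ¬ G.Adj b g)
    (hce : ¬ G.Adj c e) (hcg : ¬ G.Adj c g) (hdg : ¬ G.Adj d g) : False := by
  have key : ∀ i j,
      G.Adj (![a, b, c, d, e, g] i) (![a, b, c, d, e, g] j) ↔ (cycleGraph 6).Adj i j := by
    intro i j
    have hs := fun x y => G.adj_comm x y
    fin_cases i <;> fin_cases j <;> simp [cycleGraph_adj] <;> grind
  have hinj : ∀ i j : Fin 6,
      (∀ l, (cycleGraph 6).Adj i l ↔ (cycleGraph 6).Adj j l) → i = j := by decide +kernel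
  exact h (containsInduced_of_map _ (fun i j hij => hinj i j fun l => by
    rw [← key, ← key, hij]) key)

/-- `f` exhibits an induced copy of `T0` in `G`. -/
def IsT0 (G : SimpleGraph V) (f : Fin 9 → V) : Prop :=
  ∀ j k, G.Adj (f j) (f k) ↔ T0.Adj j k

theorem IsT0.injective {G : SimpleGraph V} {f : Fin 9 → V} (hf : IsT0 G f) :
    Function.Injective f := fun j k hjk =>
  T0_eq_of_adj_iff j k fun l => by rw [← hf, ← hf, hjk]

/-- The vertex `v` attaches to the copy `f` of `T0` like a vertex of class `i` of a tent. -/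
def HasTrace (G : SimpleGraph V) (f : Fin 9 → V) (i : Fin 14) (v : V) : Prop :=
  ∀ j, (v = f j ∨ G.Adj v (f j)) ↔ trace i j = true

theorem HasTrace.unique {G : SimpleGraph V} {f : Fin 9 → V} {i i' : Fin 14} {v : V}
    (h : HasTrace G f i v) (h' : HasTrace G f i' v) : i = i' :=
  eq_of_trace_eq_off i i' 0 fun k _ => Bool.eq_iff_iff.2 ((h k).symm.trans (h' k))

theorem IsT0.hasTrace_label {G : SimpleGraph V} {f : Fin 9 → V} (hf : IsT0 G f) (j : Fin 9) :
    HasTrace G f (label j) (f j) := fun k => by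
  rw [trace_label, hf, hf.injective.eq_iff]

theorem label_injective : Function.Injective label :=
  Fin.castLE_injective (by decide)

/-- In a `(2P_3,C_4,C_6)`-free graph, every vertex attaches to a copy of `T0` in one of the
fourteen ways allowed in a tent. -/
theorem IsT0.exists_hasTrace {G : SimpleGraph V} {f : Fin 9 → V} (hf : IsT0 G f)
    (h2P3 : HFree G twoP3) (hC4 : HFree G (cycleGraph 4)) (hC6 : HFree G (cycleGraph 6)) (v : V) :
    ∃ i, HasTrace G f i v := by
  classical
  by_cases hv : ∃ j, v = f j
  · obtain ⟨j, rfl⟩ := hv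
    exact ⟨_, hf.hasTrace_label j⟩
  push Not at hv
  have T : ∀ {j}, decide (G.Adj v (f j)) = true → G.Adj v (f j) := fun h => by simpa using h
  have F : ∀ {j}, decide (G.Adj v (f j)) = false → ¬ G.Adj v (f j) := fun h => by simpa using h
  have A : ∀ {j k}, T0.Adj j k → G.Adj (f j) (f k) := fun h => (hf _ _).2 h
  have N : ∀ {j k}, ¬ T0.Adj j k → ¬ G.Adj (f j) (f k) := fun h => mt (hf _ _).1 h
  have N' : ∀ {j k}, ¬ T0.Adj k j → ¬ G.Adj (f j) (f k) := fun h => N fun h' => h h'.symm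
  have D : ∀ {j k}, j ≠ k → f j ≠ f k := fun h => hf.injective.ne h
  obtain ⟨i, hi⟩ := exists_trace (fun j => decide (G.Adj v (f j)))
    (by
      intro i si j sj ij k sk jk hik
      by_contra nik
      exact F sj (adj_of_C4_free hC4 (A ij) (A jk) (T sk).symm (T si) (D hik) (N nik)
        (hv j).symm).symm)
    (by
      rintro i si j sj ij k ⟨sk, -, -, ki, kj⟩ l kl ⟨sl, li, lj⟩ m lm hkm nkm ⟨sm, mi, mj⟩
      exact false_of_2P3 h2P3 (T si) (A ij) (hv j) (F sj) (A kl) (A lm) (D hkm) (N nkm)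
        (F sk) (F sl) (F sm) (N' ki) (N' li) (N' mi) (N' kj) (N' lj) (N' mj))
    (by
      rintro i si j sj hij nij k ⟨sk, ki, kj⟩ l kl ⟨sl, li, lj⟩ m lm hkm nkm ⟨sm, mi, mj⟩
      exact false_of_2P3 h2P3 (T si).symm (T sj) (D hij) (N nij) (A kl) (A lm) (D hkm) (N nkm)
        (N' ki) (N' li) (N' mi) (F sk) (F sl) (F sm) (N' kj) (N' lj) (N' mj))
    (by
      intro i si j sj ij k sk jk hki nki l sl kl hlj nlj nli m sm lm nmk nmj hmi
      by_contra nmi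
      exact false_of_C6 hC6 (T si) (A ij) (A jk) (A kl) (A lm) (T sm).symm (F sj) (F sk) (F sl)
        (N' nki) (N' nli) (N' nmi) (N' nlj) (N' nmj) (N' nmk))
  refine ⟨i, fun j => ?_⟩
  rw [← hi j]
  simp [hv j]

/-- A vertex attaching to a copy of `T0` like its vertex `j` can replace this vertex. -/
theorem IsT0.update {G : SimpleGraph V} {f : Fin 9 → V} (hf : IsT0 G f) {j : Fin 9} {u : V}
    (hu : HasTrace G f (label j) u) : IsT0 G (Function.update f j u) := by
  have key : ∀ k, k ≠ j → (G.Adj u (f k) ↔ T0.Adj j k) := by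
    intro k hk
    have hne : u ≠ f k := by
      rintro rfl
      exact hk (label_injective ((hf.hasTrace_label k).unique hu))
    have := hu k
    rw [trace_label] at this
    simpa [hne, hk.symm] using this
  intro k l
  by_cases hk : k = j <;> by_cases hl : l = j
  · simp [hk, hl]
  · subst hk
    simpa [Function.update_of_ne hl] using key l hl
  · subst hl
    rw [G.adj_comm, T0.adj_comm]
    simpa [Function.update_of_ne hk] using key k hk
  · simpa [Function.update_of_ne hk, Function.update_of_ne hl] using hf k l

theorem IsT0.adj_iff_trace {G : SimpleGraph V} {f : Fin 9 → V} (hf : IsT0 G f)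
    (h2P3 : HFree G twoP3) (hC4 : HFree G (cycleGraph 4)) (hC6 : HFree G (cycleGraph 6))
    {i : Fin 14} {j : Fin 9} {v u : V} (hv : HasTrace G f i v) (hu : HasTrace G f (label j) u)
    (hvu : v ≠ u) : G.Adj v u ↔ trace i j = true := by
  obtain ⟨i', hi'⟩ := (hf.update hu).exists_hasTrace h2P3 hC4 hC6 v
  have : i = i' := by
    refine eq_of_trace_eq_off i i' j fun k hk => Bool.eq_iff_iff.2 ?_
    rw [← hv k, ← hi' k, Function.update_of_ne hk]
  subst this
  simpa [hvu] using hi' j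

theorem Complete.symm {G : SimpleGraph V} {S T : Set V} (h : Complete G S T) : Complete G T S :=
  fun a ha b hb => (h b hb a ha).symm

theorem Anticomplete.symm {G : SimpleGraph V} {S T : Set V} (h : Anticomplete G S T) :
    Anticomplete G T S :=
  fun a ha b hb hab => h b hb a ha hab.symm

/-- The sets `P 0,…,P 13` form a tent partition of `G`, with the adjacencies to the first nine
classes described by `trace`. -/
structure TentClasses (G : SimpleGraph V) (P : Fin 14 → Set V) : Prop where
  disjoint : ∀ i j, i ≠ j → Disjoint (P i) (P j)
  cover : ∀ v, ∃ i, v ∈ P i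
  nonempty : ∀ j, (P (label j)).Nonempty
  adj_iff : ∀ i j, ∀ v ∈ P i, ∀ u ∈ P (label j), v ≠ u → (G.Adj v u ↔ trace i j = true)
  isClique : ∀ i : Fin 14, 9 ≤ i → i ≤ 12 → G.IsClique (P i)
  exclusive : (P 9 = ∅ ∧ P 10 = ∅) ∨ (P 9 = ∅ ∧ P 12 = ∅) ∨ (P 10 = ∅ ∧ P 12 = ∅)
  complete_W : ∀ i : Fin 14, 9 ≤ i → i ≤ 10 → Complete G (P 11) (P i)
  anticomplete_ZY : Anticomplete G (P 13) (P 12)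
  chain_Y : ChainClosedNbhd G (P 12)
  cliques_Z : OrderedCliquesPartition G (P 13)

theorem TentClasses.isTent {G : SimpleGraph V} {P : Fin 14 → Set V} (h : TentClasses G P) :
    IsTent G := by
  refine ⟨P 0, P 1, P 2, P 3, P 4, P 5, P 6, P 7, P 8, P 9, P 10, P 11, P 12, P 13, ?_⟩
  have hP : ![P 0, P 1, P 2, P 3, P 4, P 5, P 6, P 7, P 8, P 9, P 10, P 11, P 12, P 13] = P := by
    funext i; fin_cases i <;> rfl
  have hN : ∀ {k}, (∃ j, label j = k) → (P k).Nonempty := by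
    rintro _ ⟨j, rfl⟩; exact h.nonempty j
  have hK : ∀ {k}, (∃ j, label j = k ∧ trace k j = true) → G.IsClique (P k) := by
    rintro _ ⟨j, rfl, ht⟩ v hv u hu hvu
    exact (h.adj_iff _ j v hv u hu hvu).2 ht
  have hne : ∀ {i k v u}, i ≠ k → v ∈ P i → u ∈ P k → v ≠ u := by
    rintro i k v _ hik hv hu rfl
    exact Set.disjoint_left.1 (h.disjoint i k hik) hv hu
  have hC : ∀ {i k}, (∃ j, label j = k ∧ i ≠ k ∧ trace i j = true) →
      Complete G (P i) (P k) := by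
    rintro i _ ⟨j, rfl, hij, ht⟩ v hv u hu
    exact (h.adj_iff i j v hv u hu (hne hij hv hu)).2 ht
  have hA : ∀ {i k}, (∃ j, label j = k ∧ i ≠ k ∧ trace i j = false) →
      Anticomplete G (P i) (P k) := by
    rintro i _ ⟨j, rfl, hij, ht⟩ v hv u hu hvu
    simp [(h.adj_iff i j v hv u hu (hne hij hv hu)).1 hvu] at ht
  unfold IsTentPartition
  rw [hP]
  refine ⟨h.disjoint, Set.eq_univ_of_forall fun v => Set.mem_iUnion.2 (h.cover v), ?_, ?_,
    ⟨h.isClique 9 (by decide) (by decide), h.isClique 10 (by decide) (by decide),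
      h.isClique 12 (by decide) (by decide)⟩, h.exclusive, h.isClique 11 (by decide) (by decide),
    ?_, ?_, ?_, ?_, ?_, ?_, ?_, ?_, ?_, ?_,
    ⟨hC (by decide), hC (by decide), hC (by decide), hC (by decide), hC (by decide),
      hC (by decide), hC (by decide), hC (by decide), hC (by decide),
      h.complete_W 9 (by decide) (by decide), h.complete_W 10 (by decide) (by decide)⟩,
    ?_, ⟨hA (by decide), hA (by decide), hA (by decide), hA (by decide), hA (by decide),
      hA (by decide), hA (by decide), hA (by decide), hA (by decide), h.anticomplete_ZY⟩,
    h.chain_Y, .inr h.cliques_Z⟩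
  all_goals and_intros
  all_goals first
    | exact hN (by decide) | exact hK (by decide) | exact hC (by decide) | exact hA (by decide)

theorem IsTent.exists_tentClasses {G : SimpleGraph V} (h : IsTent G) :
    ∃ P, TentClasses G P := by
  obtain ⟨A0, A1, B0, B1, B2, B3, C1, C2, C3, F2, F3, W, Y, Z, hdisj, hcov, hN, hK, hKF, hexcl, hKW,
    hA01, hA0, hA1, hB, hC, hC1, hC2, hC3, hF2, hF3, hW, hY, hZ, hchY, hchZ⟩ := h
  have key : ∀ i j, i ≠ label j →
      if trace i j = true
      then Complete G (![A0, A1, B0, B1, B2, B3, C1, C2, C3, F2, F3, W, Y, Z] i)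
        (![A0, A1, B0, B1, B2, B3, C1, C2, C3, F2, F3, W, Y, Z] (label j))
      else Anticomplete G (![A0, A1, B0, B1, B2, B3, C1, C2, C3, F2, F3, W, Y, Z] i)
        (![A0, A1, B0, B1, B2, B3, C1, C2, C3, F2, F3, W, Y, Z] (label j)) := by
    obtain ⟨_, _, _, _, _, _, _⟩ := hA0
    obtain ⟨_, _, _, _, _, _, _⟩ := hA1
    obtain ⟨_, _, _, _, _, _⟩ := hB
    obtain ⟨_, _, _⟩ := hC
    obtain ⟨_, _, _, _⟩ := hC1
    obtain ⟨_, _, _, _⟩ := hC2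
    obtain ⟨_, _, _, _⟩ := hC3
    obtain ⟨_, _, _, _, _, _, _, _, _⟩ := hF2
    obtain ⟨_, _, _, _, _, _, _, _, _⟩ := hF3
    obtain ⟨_, _, _, _, _, _, _, _, _, _, _⟩ := hW
    obtain ⟨_, _, _, _, _, _, _, _, _⟩ := hY
    obtain ⟨_, _, _, _, _, _, _, _, _, _⟩ := hZ
    intro i j
    fin_cases i <;> fin_cases j <;> intro hij <;>
      first
        | exact absurd rfl hij
        | (simp only [trace]; first | assumption | exact Complete.symm ‹_› | exact Anticomplete.symm ‹_›)
  have hcl : ∀ j, G.IsClique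
      (![A0, A1, B0, B1, B2, B3, C1, C2, C3, F2, F3, W, Y, Z] (label j)) := by
    obtain ⟨_, _, _, _, _, _, _, _, _⟩ := hK
    intro j; fin_cases j <;> assumption
  refine ⟨![A0, A1, B0, B1, B2, B3, C1, C2, C3, F2, F3, W, Y, Z], hdisj, fun v => ?_, ?_, ?_, ?_,
    hexcl, ?_, hZ.2.2.2.2.2.2.2.2.2, hchY, ?_⟩
  · exact Set.mem_iUnion.1 (hcov ▸ Set.mem_univ v)
  · obtain ⟨_, _, _, _, _, _, _, _, _⟩ := hN
    intro j; fin_cases j <;> assumption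
  · intro i j v hv u hu hvu
    by_cases hij : i = label j
    · subst hij
      exact iff_of_true (hcl j hv hu hvu) ((trace_label j j).2 (.inl rfl))
    · have := key i j hij
      split_ifs at this with ht
      · exact iff_of_true (this v hv u hu) ht
      · exact iff_of_false (this v hv u hu) ht
  · intro i h9 h12
    obtain ⟨h1, h2, h3⟩ := hKF
    fin_cases i <;> first | assumption | exact absurd h9 (by decide) | exact absurd h12 (by decide)
  · intro i h9 h10
    obtain ⟨-, -, -, -, -, -, -, -, -, h1, h2⟩ := hW
    fin_cases i <;> first | assumption | exact absurd h9 (by decide) | exact absurd h10 (by decide)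
  · rcases hchZ with hZ0 | hchZ
    · exact ⟨0, fun i => i.elim0, fun i => i.elim0, fun i => i.elim0, fun i => i.elim0,
        fun i => i.elim0, by simp [hZ0], fun i => i.elim0⟩
    · exact hchZ

/-- A finite vertex set inducing no `P_3` is a disjoint union of pairwise anticomplete cliques. -/
theorem orderedCliquesPartition_of_trans [Finite V] {G : SimpleGraph V} {Z : Set V}
    (htrans : ∀ x ∈ Z, ∀ y ∈ Z, ∀ z ∈ Z, G.Adj x y → G.Adj y z → x ≠ z → G.Adj x z)
    (hchain : ∀ x ∈ Z, ∀ y ∈ Z, G.Adj x y →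
      closedNbhd G x ⊆ closedNbhd G y ∨ closedNbhd G y ⊆ closedNbhd G x) :
    OrderedCliquesPartition G Z := by
  classical
  let S : Setoid Z :=
    { r := fun x y => x = y ∨ G.Adj x y
      iseqv :=
        { refl := fun x => .inl rfl
          symm := by
            rintro x y (rfl | h)
            exacts [.inl rfl, .inr h.symm]
          trans := by
            rintro x y z (rfl | hxy) (rfl | hyz)
            · exact .inl rfl
            · exact .inr hyz
            · exact .inr hxy
            · by_cases hxz : x = z
              · exact .inl hxz
              · exact .inr (htrans x x.2 y y.2 z z.2 hxy hyz fun h => hxz (Subtype.ext h)) } }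
  obtain ⟨ℓ, ⟨e⟩⟩ := Finite.exists_equiv_fin (Quotient S)
  have hrel : ∀ {x y : Z}, e ⟦x⟧ = e ⟦y⟧ ↔ (x = y ∨ G.Adj x y) := by
    intro x y
    rw [e.injective.eq_iff, Quotient.eq]
    rfl
  refine ⟨ℓ, fun i => {v | ∃ h : v ∈ Z, e ⟦⟨v, h⟩⟧ = i}, ?_, ?_, ?_, ?_, ?_, ?_⟩
  · intro i
    obtain ⟨⟨v, hv⟩, h⟩ := Quotient.exists_rep (e.symm i)
    exact ⟨v, hv, by rw [h, e.apply_symm_apply]⟩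
  · rintro i v ⟨hv, rfl⟩ u ⟨hu, hvu⟩ hne
    exact (hrel.1 hvu.symm).resolve_left fun h => hne (congrArg Subtype.val h)
  · intro i j hij
    rw [Set.disjoint_left]
    rintro v ⟨hv, rfl⟩ ⟨_, h⟩
    exact hij h
  · rintro i j hij v ⟨hv, rfl⟩ u ⟨hu, rfl⟩ hvu
    exact hij (hrel.2 (.inr hvu))
  · ext v
    simp
  · rintro i v ⟨hv, rfl⟩ u ⟨hu, hvu⟩
    rcases hrel.1 hvu with h | h
    · obtain rfl : u = v := congrArg Subtype.val h
      exact .inl subset_rfl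
    · exact (hchain u hu v hv h).symm

theorem IsT0.tentClasses [Finite V] {G : SimpleGraph V} {f : Fin 9 → V} (hf : IsT0 G f)
    (h2P3 : HFree G twoP3) (hC4 : HFree G (cycleGraph 4)) (hC6 : HFree G (cycleGraph 6)) :
    TentClasses G fun i => {v | HasTrace G f i v} := by
  have A : ∀ {j k}, T0.Adj j k → G.Adj (f j) (f k) := fun h => (hf _ _).2 h
  have N : ∀ {j k}, ¬ T0.Adj j k → ¬ G.Adj (f j) (f k) := fun h => mt (hf _ _).1 h
  have D : ∀ {j k}, j ≠ k → f j ≠ f k := fun h => hf.injective.ne h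
  have ne : ∀ {i v}, HasTrace G f i v → ∀ j, label j ≠ i → v ≠ f j := by
    rintro i v hv j hij rfl
    exact hij ((hf.hasTrace_label j).unique hv)
  have adj : ∀ {i v}, HasTrace G f i v → ∀ j, label j ≠ i → trace i j = true → G.Adj v (f j) := by
    intro i v hv j hij ht
    exact ((hv j).2 ht).resolve_left (ne hv j hij)
  have nadj : ∀ {i v}, HasTrace G f i v → ∀ j, trace i j = false → ¬ G.Adj v (f j) := by
    intro i v hv j ht h
    simp [(hv j).1 (.inr h)] at ht
  have nadj' : ∀ {i v}, HasTrace G f i v → ∀ j, trace i j = false → ¬ G.Adj (f j) v :=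
    fun hv j ht h => nadj hv j ht h.symm
  have trace_of_mem : ∀ {i : Fin 14} (j : Fin 9) {v u}, HasTrace G f i v →
      HasTrace G f (label j) u → v ≠ u → (G.Adj v u ↔ trace i j = true) :=
    fun j _ _ hv hu hvu => hf.adj_iff_trace h2P3 hC4 hC6 hv hu hvu
  -- vertices of classes `F_2`, `F_3`, `W` have nonadjacent common neighbors `b_0`, `b_1`
  have big : ∀ {i i' : Fin 14} {v u}, 9 ≤ i → i ≤ 11 → 9 ≤ i' → i' ≤ 11 → HasTrace G f i v →
      HasTrace G f i' u → v ≠ u → G.Adj v u := by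
    have hb : ∀ i : Fin 14, 9 ≤ i → i ≤ 11 →
        (label 2 ≠ i ∧ trace i 2 = true) ∧ (label 3 ≠ i ∧ trace i 3 = true) := by decide
    intro i i' v u h9 h11 h9' h11' hv hu hvu
    obtain ⟨⟨h1, h2⟩, h3, h4⟩ := hb i h9 h11
    obtain ⟨⟨h1', h2'⟩, h3', h4'⟩ := hb i' h9' h11'
    exact adj_of_C4_free hC4 (adj hv 2 h1 h2).symm (adj hv 3 h3 h4) (adj hu 3 h3' h4').symm
      (adj hu 2 h1' h2') (D (by decide)) (N (by decide)) hvu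
  have cliqueY : ∀ {v u}, HasTrace G f 12 v → HasTrace G f 12 u → v ≠ u → G.Adj v u := by
    intro v u hv hu hvu
    by_contra hn
    exact false_of_2P3 h2P3 (adj hv 7 (by decide) rfl) (adj hu 7 (by decide) rfl).symm hvu hn
      (A (j := 2) (k := 0) (by decide)) (A (j := 0) (k := 5) (by decide)) (D (by decide))
      (N (by decide)) (nadj hv 2 rfl) (nadj hv 0 rfl) (nadj hv 5 rfl) (N (by decide))
      (N (by decide)) (N (by decide)) (nadj hu 2 rfl) (nadj hu 0 rfl) (nadj hu 5 rfl)
  have hZY : ∀ {v u}, HasTrace G f 13 v → HasTrace G f 12 u → ¬ G.Adj v u := by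
    intro v u hv hu hvu
    exact false_of_2P3 h2P3 hvu (adj hu 7 (by decide) rfl)
      (fun h => nadj hv 8 rfl (h ▸ A (by decide))) (nadj hv 7 rfl)
      (A (j := 2) (k := 0) (by decide)) (A (j := 0) (k := 5) (by decide)) (D (by decide))
      (N (by decide)) (nadj hv 2 rfl) (nadj hv 0 rfl) (nadj hv 5 rfl) (nadj hu 2 rfl)
      (nadj hu 0 rfl) (nadj hu 5 rfl) (N (by decide)) (N (by decide)) (N (by decide))
  have hF : ∀ {v u}, HasTrace G f 9 v → HasTrace G f 10 u → False := by
    intro v u hv hu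
    have hvu : v ≠ u := fun h => absurd ((h ▸ hv).unique hu) (by decide)
    exact nadj hv 7 rfl (adj_of_C4_free hC4
      (big (by decide) (by decide) (by decide) (by decide) hu hv hvu.symm)
      (adj hv 8 (by decide) rfl) (A (by decide)) (adj hu 7 (by decide) rfl).symm
      (ne hu 8 (by decide)) (nadj hu 8 rfl) (ne hv 7 (by decide)))
  have hFY : ∀ (i : Fin 14) (b c : Fin 9) {v y},
      (label 2 ≠ i ∧ trace i 2 = true ∧ label 3 ≠ i ∧ trace i 3 = true ∧ label 6 ≠ i ∧
        trace i 6 = true ∧ label c ≠ i ∧ trace i c = false ∧ trace i b = false ∧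
        label c ≠ 12 ∧ label b ≠ 12 ∧ trace 12 c = true ∧ trace 12 b = false ∧ T0.Adj c b ∧
        T0.Adj 6 c ∧ ¬ T0.Adj b 2 ∧ ¬ T0.Adj b 3 ∧ ¬ T0.Adj c 2 ∧ ¬ T0.Adj c 3) →
      HasTrace G f i v → HasTrace G f 12 y → False := by
    intro i b c v y ⟨i2, t2, i3, t3, i6, t6, ic, tc, tb, yc, yb, tyc, tyb, cb, c6, b2, b3, c2, c3⟩
      hv hy
    by_cases hvy : G.Adj v y
    · exact nadj hv c tc (adj_of_C4_free hC4 hvy.symm (adj hv 6 i6 t6) (A c6)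
        (adj hy c yc tyc).symm (ne hy 6 (by decide)) (nadj hy 6 rfl) (ne hv c ic))
    · exact false_of_2P3 h2P3 (adj hy c yc tyc) (A cb) (ne hy b yb) (nadj hy b tyb)
        (adj hv 2 i2 t2).symm (adj hv 3 i3 t3) (D (by decide)) (N (by decide)) (nadj hy 2 rfl)
        (fun h => hvy h.symm) (nadj hy 3 rfl) (N c2) (nadj' hv c tc) (N c3) (N b2) (nadj' hv b tb)
        (N b3)
  have core : ∀ {i : Fin 14} {v u}, i < 9 → HasTrace G f i v → v ≠ u →
      ∃ j, label j = i ∧ ∀ {i'}, HasTrace G f i' u → (G.Adj u v ↔ trace i' j = true) := by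
    intro i v u hi hv hvu
    obtain ⟨j, rfl⟩ : ∃ j, label j = i := ⟨⟨i, hi⟩, rfl⟩
    exact ⟨j, rfl, fun hu => trace_of_mem j hu hv hvu.symm⟩
  have nbrZ : ∀ {v u}, HasTrace G f 13 v → G.Adj v u →
      HasTrace G f 13 u ∨ ∃ i : Fin 14, 9 ≤ i ∧ i ≤ 11 ∧ HasTrace G f i u := by
    intro v u hv hvu
    obtain ⟨i, hi⟩ := hf.exists_hasTrace h2P3 hC4 hC6 u
    by_cases h9 : i < 9
    · obtain ⟨j, rfl, hj⟩ := core h9 hi hvu.ne'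
      exact absurd ((hj hv).1 hvu) ((by decide : ∀ j, ¬ trace 13 j = true) j)
    by_cases h11 : i ≤ 11
    · exact .inr ⟨i, not_lt.1 h9, h11, hi⟩
    obtain rfl | rfl : i = 12 ∨ i = 13 :=
      (by decide : ∀ i : Fin 14, ¬ i ≤ 11 → i = 12 ∨ i = 13) i h11
    · exact absurd hvu (hZY hv hi)
    · exact .inl hi
  have hZ : ∀ {x y z}, HasTrace G f 13 x → HasTrace G f 13 y → HasTrace G f 13 z →
      G.Adj x y → G.Adj y z → x ≠ z → G.Adj x z := by
    intro x y z hx hy hz hxy hyz hxz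
    by_contra hn
    exact false_of_2P3 h2P3 hxy hyz hxz hn
      (A (j := 2) (k := 0) (by decide)) (A (j := 0) (k := 5) (by decide)) (D (by decide))
      (N (by decide)) (nadj hx 2 rfl) (nadj hx 0 rfl) (nadj hx 5 rfl) (nadj hy 2 rfl)
      (nadj hy 0 rfl) (nadj hy 5 rfl) (nadj hz 2 rfl) (nadj hz 0 rfl) (nadj hz 5 rfl)
  -- two adjacent vertices whose private neighbors are adjacent are comparable
  have chain : ∀ {x y}, G.Adj x y → (∀ u v, G.Adj x u → ¬ G.Adj y u → u ≠ y → G.Adj y v →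
      ¬ G.Adj x v → v ≠ x → u ≠ v → G.Adj u v) →
      closedNbhd G x ⊆ closedNbhd G y ∨ closedNbhd G y ⊆ closedNbhd G x := by
    intro x y hxy h
    by_contra! hn
    obtain ⟨⟨u, hxu, hyu⟩, v, hyv, hxv⟩ := hn.imp Set.not_subset.1 Set.not_subset.1
    simp only [closedNbhd, Set.mem_insert_iff, mem_neighborSet, not_or] at hxu hyu hyv hxv
    have hxu' : G.Adj x u := hxu.resolve_left (by rintro rfl; exact hyu.2 hxy.symm)
    have hyv' : G.Adj y v := hyv.resolve_left (by rintro rfl; exact hxv.2 hxy)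
    have huv : u ≠ v := by rintro rfl; exact hyu.2 hyv'
    exact hyu.2 (adj_of_C4_free hC4 hxy hyv' (h u v hxu' hyu.2 hyu.1 hyv' hxv.2 hxv.1 huv).symm
      hxu'.symm (Ne.symm hxv.1) hxv.2 (Ne.symm hyu.1))
  have nbrY : ∀ {v y u}, HasTrace G f 12 v → HasTrace G f 12 y → G.Adj v u → ¬ G.Adj y u →
      u ≠ y → HasTrace G f 11 u := by
    intro v y u hv hy hvu hyu huy
    obtain ⟨i, hi⟩ := hf.exists_hasTrace h2P3 hC4 hC6 u
    by_cases h9 : i < 9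
    · obtain ⟨j, rfl, hj⟩ := core h9 hi hvu.ne'
      obtain ⟨j', hj'j, hj'⟩ := core h9 hi huy
      obtain rfl := label_injective hj'j
      exact absurd ((hj' hy).2 ((hj hv).1 hvu)) hyu
    obtain rfl | rfl | rfl | rfl | rfl : i = 9 ∨ i = 10 ∨ i = 11 ∨ i = 12 ∨ i = 13 :=
      (by decide : ∀ i : Fin 14, ¬ i < 9 → i = 9 ∨ i = 10 ∨ i = 11 ∨ i = 12 ∨ i = 13) i h9
    · exact (hFY 9 4 7 (by decide) hi hv).elim
    · exact (hFY 10 5 8 (by decide) hi hv).elim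
    · exact hi
    · exact absurd (cliqueY hy hi huy.symm) hyu
    · exact absurd hvu.symm (hZY hi hv)
  refine ⟨?_, hf.exists_hasTrace h2P3 hC4 hC6, fun j => ⟨f j, hf.hasTrace_label j⟩, ?_, ?_, ?_, ?_,
    fun v hv u hu => hZY hv hu, ?_, ?_⟩
  · intro i j hij
    rw [Set.disjoint_left]
    exact fun v hv hv' => hij (hv.unique hv')
  · exact fun i j v hv u hu => trace_of_mem j hv hu
  · intro i h9 h12 v hv u hu hvu
    by_cases h11 : i ≤ 11
    · exact big h9 h11 h9 h11 hv hu hvu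
    · obtain rfl : i = 12 := le_antisymm h12 (not_le.1 h11)
      exact cliqueY hv hu hvu
  · simp only [Set.eq_empty_iff_forall_notMem, Set.mem_ofPred_eq]
    have h9 := fun v y => hFY 9 4 7 (v := v) (y := y) (by decide)
    have h10 := fun v y => hFY 10 5 8 (v := v) (y := y) (by decide)
    have h910 := fun v u => @hF v u
    grind
  · intro i h9 h10 v hv u hu
    refine big (by decide) (by decide) h9 (h10.trans (by decide)) hv hu ?_
    rintro rfl
    exact absurd (hv.unique hu ▸ h10) (by decide)
  · intro x hx y hy
    by_cases hxy : x = y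
    · exact .inl (hxy ▸ subset_rfl)
    refine chain (cliqueY hx hy hxy) fun u v hxu hyu huy hyv hxv hvx huv => ?_
    exact big (by decide) (by decide) (by decide) (by decide) (nbrY hx hy hxu hyu huy)
      (nbrY hy hx hyv hxv hvx) huv
  · refine orderedCliquesPartition_of_trans (fun x hx y hy z hz => hZ hx hy hz)
      fun x hx y hy hxy => chain hxy fun u v hxu hyu huy hyv hxv hvx huv => ?_
    rcases nbrZ hx hxu with hu | ⟨i, h9, h11, hu⟩
    · exact absurd (hZ hy hx hu hxy.symm hxu huy.symm) hyu
    rcases nbrZ hy hyv with hv | ⟨i', h9', h11', hv⟩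
    · exact absurd (hZ hx hy hv hxy hyv hvx.symm) hxv
    exact big h9 h11 h9' h11' hu hv huv

theorem OrderedCliquesPartition.exists_clique {G : SimpleGraph V} {Z : Set V}
    (h : OrderedCliquesPartition G Z) {x y : V} (hx : x ∈ Z) (hy : y ∈ Z) (hxy : G.Adj x y) :
    ∃ K : Set V, G.IsClique K ∧ ChainClosedNbhd G K ∧ x ∈ K ∧ y ∈ K ∧
      ∀ z ∈ Z, G.Adj y z → z ∈ K := by
  obtain ⟨ℓ, K, -, hK, -, hanti, rfl, hchain⟩ := h
  obtain ⟨i, hi⟩ := Set.mem_iUnion.1 hx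
  have hmem : ∀ {u v j}, u ∈ K j → v ∈ ⋃ i, K i → G.Adj u v → v ∈ K j := by
    intro u v j hu hv huv
    obtain ⟨j', hj'⟩ := Set.mem_iUnion.1 hv
    by_cases hjj : j = j'
    · exact hjj ▸ hj'
    · exact absurd huv (hanti j j' hjj u hu v hj')
  have hyi := hmem hi hy hxy
  exact ⟨K i, hK i, hchain i, hi, hyi, fun z hz hyz => hmem hyi hz hyz⟩

/-- A class of a tent other than `F_2`, `F_3`, `W`, `Z`. -/
def IsCore (i : Fin 14) : Prop := i < 9 ∨ i = 12

instance : DecidablePred IsCore := fun i => inferInstanceAs (Decidable (i < 9 ∨ i = 12))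

/-- Adjacency between vertices of the core classes `i` and `k` of a tent. -/
def coreAdj (i k : Fin 14) : Bool :=
  if h : k.1 < 9 then trace i ⟨k, h⟩ else if h : i.1 < 9 then trace k ⟨i, h⟩ else true

/-- The core class `k` of a tent can contain nonneighbors of a vertex of class `i ∈ {9, 10, 11}`. -/
def IsFar (i k : Fin 14) : Prop :=
  IsCore k ∧ (∀ j, label j = k → trace i j = false) ∧ (k = 12 → i = 11)

instance (i k : Fin 14) : Decidable (IsFar i k) := by unfold IsFar; infer_instance

theorem lt_nine_or (i : Fin 14) :
    (∃ j, label j = i) ∨ i = 9 ∨ i = 10 ∨ i = 11 ∨ i = 12 ∨ i = 13 := by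
  revert i; decide

theorem cases_of_mem_Icc : ∀ i : Fin 14, 9 ≤ i ∧ i ≤ 11 → i = 9 ∨ i = 10 ∨ i = 11 := by
  decide

theorem cases_of_kind : ∀ i : Fin 14, IsCore i ∨ (9 ≤ i ∧ i ≤ 11) ∨ i = 13 := by
  decide

theorem isCore_label : ∀ j, IsCore (label j) := by decide

theorem coreAdj_label : ∀ i j, coreAdj i (label j) = trace i j := by decide

theorem coreAdj_comm : ∀ i k, IsCore i → IsCore k → coreAdj i k = coreAdj k i := by
  decide +kernel

theorem coreAdj_of_isFar : ∀ i : Fin 14, 9 ≤ i ∧ i ≤ 11 → ∀ k, IsFar i k → ∀ k', IsFar i k' →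
    coreAdj k k' = true := by
  decide +kernel

theorem coreAdj_of_common : ∀ i : Fin 14, 9 ≤ i ∧ i ≤ 11 → ∀ k, IsFar i k →
    ∀ j, trace i j = true → coreAdj k (label j) = true →
    ∀ j', trace i j' = true → coreAdj k (label j') = true → trace (label j) j' = true := by
  decide +kernel

namespace TentClasses

variable {G : SimpleGraph V} {P : Fin 14 → Set V}

theorem class_unique (h : TentClasses G P) {i k : Fin 14} {v : V} (hi : v ∈ P i) (hk : v ∈ P k) :
    i = k := by
  by_contra hik
  exact Set.disjoint_left.1 (h.disjoint i k hik) hi hk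

theorem false_of_nine_ten (h : TentClasses G P) {v u : V} (hv : v ∈ P 9) (hu : u ∈ P 10) :
    False := by
  rcases h.exclusive with ⟨h1, h2⟩ | ⟨h1, h2⟩ | ⟨h1, h2⟩ <;> simp_all

theorem false_of_nine_twelve (h : TentClasses G P) {v u : V} (hv : v ∈ P 9) (hu : u ∈ P 12) :
    False := by
  rcases h.exclusive with ⟨h1, h2⟩ | ⟨h1, h2⟩ | ⟨h1, h2⟩ <;> simp_all

theorem false_of_ten_twelve (h : TentClasses G P) {v u : V} (hv : v ∈ P 10) (hu : u ∈ P 12) :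
    False := by
  rcases h.exclusive with ⟨h1, h2⟩ | ⟨h1, h2⟩ | ⟨h1, h2⟩ <;> simp_all

/-- The union of the classes `F_2`, `F_3`, `W` is a clique. -/
theorem adj_of_FW (h : TentClasses G P) {i k : Fin 14} (hi : 9 ≤ i ∧ i ≤ 11) (hk : 9 ≤ k ∧ k ≤ 11)
    {v u : V} (hv : v ∈ P i) (hu : u ∈ P k) (hvu : v ≠ u) : G.Adj v u := by
  have hW := fun i h9 h10 v hv u hu => (h.complete_W i h9 h10 v hv u hu)
  rcases cases_of_mem_Icc i hi with rfl | rfl | rfl <;>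
    rcases cases_of_mem_Icc k hk with rfl | rfl | rfl
  · exact h.isClique 9 (by decide) (by decide) hv hu hvu
  · exact (h.false_of_nine_ten hv hu).elim
  · exact (hW 9 (by decide) (by decide) u hu v hv).symm
  · exact (h.false_of_nine_ten hu hv).elim
  · exact h.isClique 10 (by decide) (by decide) hv hu hvu
  · exact (hW 10 (by decide) (by decide) u hu v hv).symm
  · exact hW 9 (by decide) (by decide) v hv u hu
  · exact hW 10 (by decide) (by decide) v hv u hu
  · exact h.isClique 11 (by decide) (by decide) hv hu hvu

theorem adj_iff_coreAdj (h : TentClasses G P) {i k : Fin 14} (hi : IsCore i) (hk : IsCore k)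
    {v u : V} (hv : v ∈ P i) (hu : u ∈ P k) (hvu : v ≠ u) :
    G.Adj v u ↔ coreAdj i k = true := by
  rcases hk with hk | rfl
  · obtain ⟨j, rfl⟩ : ∃ j, label j = k := ⟨⟨k, hk⟩, rfl⟩
    rw [coreAdj_label, h.adj_iff i j v hv u hu hvu]
  · rcases hi with hi' | rfl
    · obtain ⟨j, rfl⟩ : ∃ j, label j = i := ⟨⟨i, hi'⟩, rfl⟩
      rw [coreAdj_comm _ _ (isCore_label j) (.inr rfl), coreAdj_label, G.adj_comm,
        h.adj_iff 12 j u hu v hv hvu.symm]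
    · exact iff_of_true (h.isClique 12 (by decide) (by decide) hv hu hvu) rfl

theorem not_adj_Z_core (h : TentClasses G P) {k : Fin 14} (hk : IsCore k) {v u : V}
    (hv : v ∈ P 13) (hu : u ∈ P k) : ¬ G.Adj v u := by
  intro hvu
  rcases hk with hk | rfl
  · obtain ⟨j, rfl⟩ : ∃ j, label j = k := ⟨⟨k, hk⟩, rfl⟩
    exact absurd ((h.adj_iff 13 j v hv u hu hvu.ne).1 hvu) ((by decide : ∀ j, ¬ trace 13 j = true) j)
  · exact h.anticomplete_ZY v hv u hu hvu

theorem mem_Z_or_FW_of_adj (h : TentClasses G P) {v u : V} (hv : v ∈ P 13) (hvu : G.Adj v u) :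
    u ∈ P 13 ∨ ∃ i : Fin 14, (9 ≤ i ∧ i ≤ 11) ∧ u ∈ P i := by
  obtain ⟨i, hi⟩ := h.cover u
  rcases cases_of_kind i with hc | hF | rfl
  · exact absurd hvu (h.not_adj_Z_core hc hv hi)
  · exact .inr ⟨i, hF, hi⟩
  · exact .inl hi

theorem adj_trans_Z (h : TentClasses G P) {x y z : V} (hx : x ∈ P 13) (hy : y ∈ P 13)
    (hz : z ∈ P 13) (hxy : G.Adj x y) (hyz : G.Adj y z) (hxz : x ≠ z) : G.Adj x z := by
  obtain ⟨K, hK, -, hxK, -, hzK⟩ := h.cliques_Z.exists_clique hx hy hxy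
  exact hK hxK (hzK z hz hyz) hxz

theorem far_of_not_adj (h : TentClasses G P) {i : Fin 14} (hi : 9 ≤ i ∧ i ≤ 11) {v x : V}
    (hv : v ∈ P i) (hvx : v ≠ x) (nvx : ¬ G.Adj v x) :
    x ∈ P 13 ∨ ∃ k, IsFar i k ∧ x ∈ P k := by
  obtain ⟨k, hk⟩ := h.cover x
  rcases cases_of_kind k with hc | hF | rfl
  · refine .inr ⟨k, ⟨hc, ?_, ?_⟩, hk⟩
    · rintro j rfl
      simpa using mt (h.adj_iff i j v hv x hk hvx).2 nvx
    · rintro rfl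
      rcases cases_of_mem_Icc i hi with rfl | rfl | rfl
      · exact (h.false_of_nine_twelve hv hk).elim
      · exact (h.false_of_ten_twelve hv hk).elim
      · rfl
  · exact absurd (h.adj_of_FW hi hF hv hk hvx) nvx
  · exact .inl hk

/-- The nonneighbors of a vertex of class `F_2`, `F_3` or `W` induce no `P_3`. -/
theorem adj_trans_of_not_adj (h : TentClasses G P) {i : Fin 14} (hi : 9 ≤ i ∧ i ≤ 11)
    {v x y z : V} (hv : v ∈ P i) (hvx : v ≠ x) (nvx : ¬ G.Adj v x) (hvy : v ≠ y)
    (nvy : ¬ G.Adj v y) (hvz : v ≠ z) (nvz : ¬ G.Adj v z) (hxy : G.Adj x y) (hyz : G.Adj y z)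
    (hxz : x ≠ z) : G.Adj x z := by
  rcases h.far_of_not_adj hi hv hvx nvx with hx | ⟨k, fk, hx⟩ <;>
    rcases h.far_of_not_adj hi hv hvy nvy with hy | ⟨l, fl, hy⟩ <;>
    rcases h.far_of_not_adj hi hv hvz nvz with hz | ⟨m, fm, hz⟩
  · exact h.adj_trans_Z hx hy hz hxy hyz hxz
  · exact absurd hyz (h.not_adj_Z_core fm.1 hy hz)
  · exact absurd hxy (h.not_adj_Z_core fl.1 hx hy)
  · exact absurd hxy (h.not_adj_Z_core fl.1 hx hy)
  · exact absurd hxy.symm (h.not_adj_Z_core fk.1 hy hx)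
  · exact absurd hxy.symm (h.not_adj_Z_core fk.1 hy hx)
  · exact absurd hyz.symm (h.not_adj_Z_core fl.1 hz hy)
  · exact (h.adj_iff_coreAdj fk.1 fm.1 hx hz hxz).2 (coreAdj_of_isFar i hi k fk m fm)

end TentClasses

/-- If `x` and `p` have comparable closed neighborhoods and `v` is adjacent to `p` but not to `x`,
then every other neighbor of `x` is a neighbor of `p`. -/
theorem ChainClosedNbhd.adj {G : SimpleGraph V} {K : Set V} (hK : ChainClosedNbhd G K)
    {x p q v : V} (hx : x ∈ K) (hp : p ∈ K) (hvp : G.Adj v p) (nvx : ¬ G.Adj v x) (hvx : v ≠ x)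
    (hxq : G.Adj x q) (hpq : p ≠ q) : G.Adj p q := by
  rcases hK x hx p hp with hs | hs
  · exact (hs (.inr hxq : q ∈ closedNbhd G x)).resolve_left hpq.symm
  · rcases hs (.inr hvp.symm : v ∈ closedNbhd G p) with h | h
    · exact absurd h hvx
    · exact absurd (G.symm.symm _ _ h) nvx

namespace TentClasses

variable {G : SimpleGraph V} {P : Fin 14 → Set V}

theorem common_nbr_cases (h : TentClasses G P) {i k : Fin 14} (hi : 9 ≤ i ∧ i ≤ 11)
    (hk : IsFar i k) {v x p : V} (hv : v ∈ P i) (hx : x ∈ P k) (hxp : G.Adj x p) :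
    (k = 12 ∧ p ∈ P 12) ∨ p ∈ P 11 ∨ ∃ j, p ∈ P (label j) := by
  have hk' : k = 12 ∨ ∃ j, label j = k ∧ trace i j = false := by
    rcases hk.1 with h9 | h12
    · exact .inr ⟨⟨k, h9⟩, rfl, hk.2.1 _ rfl⟩
    · exact .inl h12
  have h11 : ∀ j, trace 11 j ≠ false := by decide
  obtain ⟨l, hl⟩ := h.cover p
  rcases lt_nine_or l with ⟨j, rfl⟩ | rfl | rfl | rfl | rfl | rfl
  · exact .inr (.inr ⟨j, hl⟩)
  · rcases hk' with rfl | ⟨j, rfl, hj⟩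
    · exact (h.false_of_nine_twelve hl hx).elim
    have := (h.adj_iff 9 j p hl x hx hxp.ne').1 hxp.symm
    rcases cases_of_mem_Icc i hi with rfl | rfl | rfl
    · simp [hj] at this
    · exact (h.false_of_nine_ten hl hv).elim
    · exact absurd hj (h11 j)
  · rcases hk' with rfl | ⟨j, rfl, hj⟩
    · exact (h.false_of_ten_twelve hl hx).elim
    have := (h.adj_iff 10 j p hl x hx hxp.ne').1 hxp.symm
    rcases cases_of_mem_Icc i hi with rfl | rfl | rfl
    · exact (h.false_of_nine_ten hv hl).elim
    · simp [hj] at this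
    · exact absurd hj (h11 j)
  · exact .inr (.inl hl)
  · rcases hk' with rfl | ⟨j, rfl, hj⟩
    · exact .inl ⟨rfl, hl⟩
    rcases cases_of_mem_Icc i hi with rfl | rfl | rfl
    · exact (h.false_of_nine_twelve hv hl).elim
    · exact (h.false_of_ten_twelve hv hl).elim
    · exact absurd hj (h11 j)
  · exact absurd hxp.symm (h.not_adj_Z_core hk.1 hl hx)

/-- The common neighbors of two nonadjacent vertices, one of class `F_2`, `F_3` or `W`, form a
clique. -/
theorem adj_of_common (h : TentClasses G P) {i : Fin 14} (hi : 9 ≤ i ∧ i ≤ 11) {v x p q : V}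
    (hv : v ∈ P i) (hvx : v ≠ x) (nvx : ¬ G.Adj v x) (hvp : G.Adj v p) (hvq : G.Adj v q)
    (hxp : G.Adj x p) (hxq : G.Adj x q) (hpq : p ≠ q) : G.Adj p q := by
  rcases h.far_of_not_adj hi hv hvx nvx with hx | ⟨k, fk, hx⟩
  · rcases h.mem_Z_or_FW_of_adj hx hxp with hp | ⟨l, hl, hp⟩
    · obtain ⟨K, -, hK, hxK, hpK, -⟩ := h.cliques_Z.exists_clique hx hp hxp
      exact hK.adj hxK hpK hvp nvx hvx hxq hpq
    rcases h.mem_Z_or_FW_of_adj hx hxq with hq | ⟨m, hm, hq⟩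
    · obtain ⟨K, -, hK, hxK, hqK, -⟩ := h.cliques_Z.exists_clique hx hq hxq
      exact (hK.adj hxK hqK hvq nvx hvx hxp hpq.symm).symm
    · exact h.adj_of_FW hl hm hp hq hpq
  rcases h.common_nbr_cases hi fk hv hx hxp with ⟨rfl, hp⟩ | hp | ⟨j, hp⟩
  · exact h.chain_Y.adj hx hp hvp nvx hvx hxq hpq
  all_goals rcases h.common_nbr_cases hi fk hv hx hxq with ⟨rfl, hq⟩ | hq | ⟨j', hq⟩
  · exact (h.chain_Y.adj hx hq hvq nvx hvx hxp hpq.symm).symm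
  · exact h.isClique 11 (by decide) (by decide) hp hq hpq
  · exact (h.adj_iff 11 j' p hp q hq hpq).2 ((by decide : ∀ j, trace 11 j = true) j')
  · exact (h.chain_Y.adj hx hq hvq nvx hvx hxp hpq.symm).symm
  · exact ((h.adj_iff 11 j q hq p hp hpq.symm).2 ((by decide : ∀ j, trace 11 j = true) j)).symm
  · refine (h.adj_iff _ j' p hp q hq hpq).2 (coreAdj_of_common i hi k fk j ?_ ?_ j' ?_ ?_)
    · exact (h.adj_iff i j v hv p hp hvp.ne).1 hvp
    · exact (h.adj_iff_coreAdj fk.1 (isCore_label j) hx hp hxp.ne).1 hxp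
    · exact (h.adj_iff i j' v hv q hq hvq.ne).1 hvq
    · exact (h.adj_iff_coreAdj fk.1 (isCore_label j') hx hq hxq.ne).1 hxq

end TentClasses

/-- The core classes of a tent contain no induced `C_4`. -/
theorem core_C4_free : ∀ a, IsCore a → ∀ b, IsCore b → coreAdj a b = true →
    ∀ c, IsCore c → coreAdj b c = true → coreAdj a c = false →
    ∀ d, IsCore d → coreAdj c d = true → coreAdj d a = true → coreAdj b d = true := by
  decide +kernel

/-- The core classes of a tent contain no induced `C_6`. -/
theorem core_C6_free : ∀ a, IsCore a → ∀ b, IsCore b → coreAdj a b = true →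
    ∀ c, IsCore c → coreAdj b c = true → coreAdj a c = false →
    ∀ d, IsCore d → coreAdj c d = true → coreAdj a d = false → coreAdj b d = false →
    ∀ e, IsCore e → coreAdj d e = true → coreAdj b e = false → coreAdj c e = false →
      coreAdj a e = false →
    ∀ g, IsCore g → coreAdj e g = true → coreAdj g a = true → coreAdj b g = false →
      coreAdj c g = false → coreAdj d g = true := by
  decide +kernel

set_option synthInstance.maxSize 1000 in
set_option synthInstance.maxHeartbeats 400000 in
/-- The core classes of a tent contain no induced `C_7`. -/
theorem core_C7_free : ∀ a, IsCore a → ∀ b, IsCore b → coreAdj a b = true →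
    ∀ c, IsCore c → coreAdj b c = true → coreAdj a c = false →
    ∀ d, IsCore d → coreAdj c d = true → coreAdj a d = false → coreAdj b d = false →
    ∀ e, IsCore e → coreAdj d e = true → coreAdj a e = false → coreAdj b e = false →
      coreAdj c e = false →
    ∀ g, IsCore g → coreAdj e g = true → coreAdj a g = false → coreAdj b g = false →
      coreAdj c g = false → coreAdj d g = false →
    ∀ k, IsCore k → coreAdj g k = true → coreAdj k a = true → coreAdj b k = false →
      coreAdj c k = false → coreAdj d k = false → coreAdj e k = true := by
  decide +kernel

/-- The core classes of a tent contain no induced `2P_3`. -/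
theorem core_2P3_free : ∀ a, IsCore a → ∀ b, IsCore b → coreAdj a b = true →
    ∀ c, IsCore c → coreAdj b c = true → coreAdj a c = false →
    ∀ d, IsCore d → coreAdj a d = false → coreAdj b d = false → coreAdj c d = false →
    ∀ e, IsCore e → coreAdj d e = true → coreAdj a e = false → coreAdj b e = false →
      coreAdj c e = false →
    ∀ g, IsCore g → coreAdj e g = true → coreAdj a g = false → coreAdj b g = false →
      coreAdj c g = false → coreAdj d g = true := by
  decide +kernel

namespace TentClasses

variable {G : SimpleGraph V} {P : Fin 14 → Set V}

/-- An induced copy in a tent of a graph in which every vertex is the beginning or the center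
of a `P_3` lies in the core classes if it avoids the classes `F_2`, `F_3`, `W`. -/
theorem exists_core_labels (h : TentClasses G P) {n : ℕ} {H : SimpleGraph (Fin n)} (e : H ↪g G)
    (hFW : ∀ a, ∀ i : Fin 14, 9 ≤ i ∧ i ≤ 11 → e a ∉ P i)
    (hP3 : ∀ a, ∃ x y z, (a = x ∨ a = y) ∧ H.Adj x y ∧ H.Adj y z ∧ x ≠ z ∧ ¬ H.Adj x z) :
    ∃ t : Fin n → Fin 14, (∀ a, IsCore (t a)) ∧
      ∀ a b, a ≠ b → (coreAdj (t a) (t b) = true ↔ H.Adj a b) := by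
  have hZ : ∀ a, e a ∉ P 13 := by
    intro a ha
    have step : ∀ {x y}, H.Adj x y → e x ∈ P 13 → e y ∈ P 13 := by
      intro x y hxy hx
      rcases h.mem_Z_or_FW_of_adj hx (e.map_adj_iff.2 hxy) with hy | ⟨i, hi, hy⟩
      · exact hy
      · exact absurd hy (hFW y i hi)
    obtain ⟨x, y, z, hxy, axy, ayz, hxz, nxz⟩ := hP3 a
    have hx : e x ∈ P 13 := by
      rcases hxy with rfl | rfl
      · exact ha
      · exact step axy.symm ha
    have hy := step axy hx
    exact nxz (e.map_adj_iff.1 (h.adj_trans_Z hx hy (step ayz hy) (e.map_adj_iff.2 axy)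
      (e.map_adj_iff.2 ayz) (e.injective.ne hxz)))
  choose t ht using fun a => h.cover (e a)
  have hc : ∀ a, IsCore (t a) := by
    intro a
    rcases cases_of_kind (t a) with hc | hF | hz
    · exact hc
    · exact absurd (ht a) (hFW a _ hF)
    · exact absurd (hz ▸ ht a) (hZ a)
  refine ⟨t, hc, fun a b hab => ?_⟩
  rw [← h.adj_iff_coreAdj (hc a) (hc b) (ht a) (ht b) (e.injective.ne hab), e.map_adj_iff]

/-- No vertex of class `F_2`, `F_3` or `W` lies in an induced copy of a graph in which the
nonneighbors of every vertex induce a `P_3`. -/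
theorem notMem_FW_of_far_P3 (h : TentClasses G P) {n : ℕ} {H : SimpleGraph (Fin n)} (e : H ↪g G)
    (hfar : ∀ a, ∃ x y z, a ≠ x ∧ ¬ H.Adj a x ∧ a ≠ y ∧ ¬ H.Adj a y ∧ a ≠ z ∧ ¬ H.Adj a z ∧
      H.Adj x y ∧ H.Adj y z ∧ x ≠ z ∧ ¬ H.Adj x z) (a : Fin n) (i : Fin 14)
    (hi : 9 ≤ i ∧ i ≤ 11) : e a ∉ P i := by
  intro ha
  obtain ⟨x, y, z, ax, nax, ay, nay, az, naz, xy, yz, xz, nxz⟩ := hfar a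
  have hn : ∀ {x y}, ¬ H.Adj x y → ¬ G.Adj (e x) (e y) := fun h => mt e.map_adj_iff.1 h
  exact hn nxz (h.adj_trans_of_not_adj hi ha (e.injective.ne ax) (hn nax) (e.injective.ne ay)
    (hn nay) (e.injective.ne az) (hn naz) (e.map_adj_iff.2 xy) (e.map_adj_iff.2 yz)
    (e.injective.ne xz))

theorem C4_free (h : TentClasses G P) : HFree G (cycleGraph 4) := by
  rw [HFree, containsInduced_iff]
  rintro ⟨e⟩
  obtain ⟨t, hc, ht⟩ := h.exists_core_labels e
    (by
      intro a i hi ha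
      obtain ⟨x, p, q, hax, nax, ap, aq, xp, xq, hpq, npq⟩ : ∃ x p q, a ≠ x ∧
          ¬ (cycleGraph 4).Adj a x ∧ (cycleGraph 4).Adj a p ∧ (cycleGraph 4).Adj a q ∧
          (cycleGraph 4).Adj x p ∧ (cycleGraph 4).Adj x q ∧ p ≠ q ∧
          ¬ (cycleGraph 4).Adj p q := by
        clear ha; revert a; decide +kernel
      exact npq (e.map_adj_iff.1 (h.adj_of_common hi ha (e.injective.ne hax)
        (mt e.map_adj_iff.1 nax) (e.map_adj_iff.2 ap) (e.map_adj_iff.2 aq) (e.map_adj_iff.2 xp)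
        (e.map_adj_iff.2 xq) (e.injective.ne hpq))))
    (by decide +kernel)
  have T : ∀ a b, (cycleGraph 4).Adj a b → coreAdj (t a) (t b) = true :=
    fun a b hab => (ht a b hab.ne).2 hab
  have F : ∀ a b, a ≠ b ∧ ¬ (cycleGraph 4).Adj a b → coreAdj (t a) (t b) = false :=
    fun a b hab => by simpa using mt (ht a b hab.1).1 hab.2
  have := core_C4_free (t 0) (hc 0) (t 1) (hc 1) (T 0 1 (by decide)) (t 2) (hc 2)
    (T 1 2 (by decide)) (F 0 2 (by decide)) (t 3) (hc 3) (T 2 3 (by decide)) (T 3 0 (by decide))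
  simp [F 1 3 (by decide)] at this

theorem C6_free (h : TentClasses G P) : HFree G (cycleGraph 6) := by
  rw [HFree, containsInduced_iff]
  rintro ⟨e⟩
  obtain ⟨t, hc, ht⟩ := h.exists_core_labels e
    (h.notMem_FW_of_far_P3 e (by decide +kernel)) (by decide +kernel)
  have T : ∀ a b, (cycleGraph 6).Adj a b → coreAdj (t a) (t b) = true :=
    fun a b hab => (ht a b hab.ne).2 hab
  have F : ∀ a b, a ≠ b ∧ ¬ (cycleGraph 6).Adj a b → coreAdj (t a) (t b) = false :=
    fun a b hab => by simpa using mt (ht a b hab.1).1 hab.2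
  have := core_C6_free (t 0) (hc 0) (t 1) (hc 1) (T 0 1 (by decide)) (t 2) (hc 2)
    (T 1 2 (by decide)) (F 0 2 (by decide)) (t 3) (hc 3) (T 2 3 (by decide)) (F 0 3 (by decide))
    (F 1 3 (by decide)) (t 4) (hc 4) (T 3 4 (by decide)) (F 1 4 (by decide)) (F 2 4 (by decide))
    (F 0 4 (by decide)) (t 5) (hc 5) (T 4 5 (by decide)) (T 5 0 (by decide)) (F 1 5 (by decide))
    (F 2 5 (by decide))
  simp [F 3 5 (by decide)] at this

theorem C7_free (h : TentClasses G P) : HFree G (cycleGraph 7) := by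
  rw [HFree, containsInduced_iff]
  rintro ⟨e⟩
  obtain ⟨t, hc, ht⟩ := h.exists_core_labels e
    (h.notMem_FW_of_far_P3 e (by decide +kernel)) (by decide +kernel)
  have T : ∀ a b, (cycleGraph 7).Adj a b → coreAdj (t a) (t b) = true :=
    fun a b hab => (ht a b hab.ne).2 hab
  have F : ∀ a b, a ≠ b ∧ ¬ (cycleGraph 7).Adj a b → coreAdj (t a) (t b) = false :=
    fun a b hab => by simpa using mt (ht a b hab.1).1 hab.2
  have := core_C7_free (t 0) (hc 0) (t 1) (hc 1) (T 0 1 (by decide)) (t 2) (hc 2)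
    (T 1 2 (by decide)) (F 0 2 (by decide)) (t 3) (hc 3) (T 2 3 (by decide)) (F 0 3 (by decide))
    (F 1 3 (by decide)) (t 4) (hc 4) (T 3 4 (by decide)) (F 0 4 (by decide)) (F 1 4 (by decide))
    (F 2 4 (by decide)) (t 5) (hc 5) (T 4 5 (by decide)) (F 0 5 (by decide)) (F 1 5 (by decide))
    (F 2 5 (by decide)) (F 3 5 (by decide)) (t 6) (hc 6) (T 5 6 (by decide)) (T 6 0 (by decide))
    (F 1 6 (by decide)) (F 2 6 (by decide)) (F 3 6 (by decide))
  simp [F 4 6 (by decide)] at this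

theorem twoP3_free (h : TentClasses G P) : HFree G twoP3 := by
  rw [HFree, containsInduced_iff]
  rintro ⟨e⟩
  obtain ⟨t, hc, ht⟩ := h.exists_core_labels e
    (h.notMem_FW_of_far_P3 e (by decide +kernel)) (by decide +kernel)
  have T : ∀ a b, twoP3.Adj a b → coreAdj (t a) (t b) = true :=
    fun a b hab => (ht a b hab.ne).2 hab
  have F : ∀ a b, a ≠ b ∧ ¬ twoP3.Adj a b → coreAdj (t a) (t b) = false :=
    fun a b hab => by simpa using mt (ht a b hab.1).1 hab.2
  have := core_2P3_free (t 0) (hc 0) (t 1) (hc 1) (T 0 1 (by decide)) (t 2) (hc 2)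
    (T 1 2 (by decide)) (F 0 2 (by decide)) (t 3) (hc 3) (F 0 3 (by decide)) (F 1 3 (by decide))
    (F 2 3 (by decide)) (t 4) (hc 4) (T 3 4 (by decide)) (F 0 4 (by decide)) (F 1 4 (by decide))
    (F 2 4 (by decide)) (t 5) (hc 5) (T 4 5 (by decide)) (F 0 5 (by decide)) (F 1 5 (by decide))
    (F 2 5 (by decide))
  simp [F 3 5 (by decide)] at this

theorem containsInduced_T0 (h : TentClasses G P) : ContainsInduced G T0 := by
  choose f hf using h.nonempty
  have hinj : Function.Injective f := fun j k hjk =>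
    label_injective (h.class_unique (hf j) (hjk ▸ hf k))
  refine containsInduced_of_map f hinj fun j k => ?_
  by_cases hjk : j = k
  · simp [hjk]
  · rw [h.adj_iff _ k _ (hf j) _ (hf k) (hinj.ne hjk), trace_label]
    simp [hjk]

end TentClasses

/-- A graph is `(2P_3,C_4,C_6,C_7)`-free and contains an induced `T_0` if and only if
it is a tent. -/
theorem statement10 {V : Type*} [Fintype V] (G : SimpleGraph V) :
    (HFree G twoP3 ∧ HFree G (cycleGraph 4) ∧ HFree G (cycleGraph 6) ∧
      HFree G (cycleGraph 7) ∧ ContainsInduced G T0) ↔ IsTent G := by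
  constructor
  · rintro ⟨h2P3, hC4, hC6, -, hT0⟩
    obtain ⟨e⟩ := containsInduced_iff.1 hT0
    have hf : IsT0 G e := fun j k => e.map_adj_iff
    exact (hf.tentClasses h2P3 hC4 hC6).isTent
  · intro h
    obtain ⟨P, hP⟩ := h.exists_tentClasses
    exact ⟨hP.twoP3_free, hP.C4_free, hP.C6_free, hP.C7_free, hP.containsInduced_T0⟩

end Paper2P3
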